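/- Fix d ≥ 1, N ≥ 1 and i ∈ {1,…,d}. Let X : [0,T] × [0,T] → H* be a family of linear functionals on the forest algebra H satisfying Chen's relation: ⟨X_{s,t}, 𝔥⟩ = Σ_{(𝔥)} ⟨X_{s,u}, 𝔥^{(1)}⟩ ⟨X_{u,t}, 𝔥^{(2)}⟩ for all forests 𝔥 and all s, u, t ∈ [0,T]. Let Z : [0,T] → H_{N−1} be any path in the span of forests of order at most N−1 (including the empty forest 1), with coefficients ⟨𝔥, Z(t)⟩, and define for each forest 𝔥 with |𝔥| ≤ N−1 the remainder R^𝔥_{s,t} := ⟨𝔥, Z(t)⟩ − Σ_{𝔤 : |𝔤| ≤ N−1} Σ_{(𝔤)} 1_{{𝔤^{(2)} = 𝔥}} ⟨X_{s,t}, 𝔤^{(1)}⟩ ⟨𝔤, Z(s)⟩. Define Z̃_{s,t} := Σ_{𝔥 : |𝔥| ≤ N−1} ⟨𝔥, Z(s)⟩ ⟨X_{s,t}, [𝔥]_i⟩, the sum running over all forests of order at most N−1 including 1. Then for all s, u, t ∈ [0,T]: Z̃_{s,t} − Z̃_{s,u} − Z̃_{u,t} = − Σ_{𝔥 : |𝔥|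 ≤ N−1} ⟨X_{u,t}, [𝔥]_i⟩ R^𝔥_{s,u}. -/

import Mathlib

open scoped Classical

/-- Labeled rooted trees with vertex labels in `Fin d`: `node a ts` attaches the trees in
`ts` (in any order) to a new root labeled `a`; `•_a = [1]_a = node a []`. -/
inductive LTree (d : ℕ) where
  | node : Fin d → List (LTree d) → LTree d

/-- Forests: finite (commutative) products of labeled trees; `1` is the empty forest.
We realize them as elements of the free monoid on trees. -/
abbrev Forest (d : ℕ) := FreeMonoid (LTree d)

namespace LTree

/-- Number of vertices of a tree. -/
def size {d : ℕ} : LTree d → ℕ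
  | .node _ ts => 1 + (ts.attach.map fun ⟨t, _⟩ => size t).sum

end LTree

/-- `|τ₁⋯τ_m| = |τ₁| + … + |τ_m|`, the order (number of vertices) of a forest. -/
def Forest.order {d : ℕ} (f : Forest d) : ℕ := (f.toList.map LTree.size).sum

/-- The grafting operator `B₊^a`: `[𝔥]_a` attaches all trees of the forest `𝔥` to a new
root labeled `a` (in particular `[1]_a = •_a`), regarded as a single-tree forest. -/
def graft {d : ℕ} (a : Fin d) (f : Forest d) : Forest d :=
  FreeMonoid.of (LTree.node a f.toList)

/-- Formal finite sums of elementary tensors `𝔥⁽¹⁾ ⊗ 𝔥⁽²⁾` of forests with real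
coefficients, represented as lists of (pair of forests, coefficient). -/
abbrev Tensor (d : ℕ) := List ((Forest d × Forest d) × ℝ)

/-- `1 ⊗ 1`. -/
def Tensor.one (d : ℕ) : Tensor d := [((1, 1), 1)]

/-- Componentwise product on `H ⊗ H` (forest concatenation in each component,
product of coefficients). -/
def Tensor.mul {d : ℕ} (p q : Tensor d) : Tensor d :=
  p.flatMap fun a => q.map fun b => ((a.1.1 * b.1.1, a.1.2 * b.1.2), a.2 * b.2)

/-- The Connes–Kreimer coproduct on trees, `Δτ = Σ_{(τ)} τ⁽¹⁾ ⊗ τ⁽²⁾`: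
`Δ[τ₁⋯τ_m]_a = [τ₁⋯τ_m]_a ⊗ 1 + (id ⊗ B₊^a)(Δτ₁ ⋯ Δτ_m)`. -/
def coprodT {d : ℕ} : LTree d → Tensor d
  | .node a ts =>
      ((FreeMonoid.of (LTree.node a ts), (1 : Forest d)), (1 : ℝ)) ::
        (((ts.attach.map fun ⟨τ, _⟩ => coprodT τ).foldr Tensor.mul (Tensor.one d)).map
          fun q => ((q.1.1, graft a q.1.2), q.2))

/-- The coproduct on forests: `Δ(τ₁⋯τ_m) = Δτ₁ ⋯ Δτ_m`, `Δ1 = 1 ⊗ 1`. -/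
def coprodF {d : ℕ} (f : Forest d) : Tensor d :=
  (f.toList.map coprodT).foldr Tensor.mul (Tensor.one d)

/-- Sweedler evaluation: `Σ_{(𝔥)} ⟨F, 𝔥⁽¹⁾⟩⟨G, 𝔥⁽²⁾⟩` for functionals `F, G` on forests. -/
def sweedler {d : ℕ} (F G : Forest d → ℝ) (f : Forest d) : ℝ :=
  ((coprodF f).map fun q => q.2 * F q.1.1 * G q.1.2).sum

/-- The remainder of a controlled path: `R^𝔥_{s,t} = ⟨𝔥, Z(t)⟩ −
Σ_{𝔤 : |𝔤| ≤ N−1} Σ_{(𝔤)} 1_{𝔤⁽²⁾ = 𝔥} ⟨X_{s,t}, 𝔤⁽¹⁾⟩ ⟨𝔤, Z(s)⟩`. -/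
noncomputable def Rrem {d : ℕ} (N : ℕ) (X : ℝ → ℝ → Forest d → ℝ)
    (Z : ℝ → Forest d → ℝ) (f : Forest d) (s t : ℝ) : ℝ :=
  Z t f -
    ∑ᶠ g ∈ {g : Forest d | g.order ≤ N - 1},
      Z s g * ((coprodF g).map fun q => if q.1.2 = f then q.2 * X s t q.1.1 else 0).sum

/-- `Z̃_{s,t} = Σ_{𝔥 : |𝔥| ≤ N−1} ⟨𝔥, Z(s)⟩ ⟨X_{s,t}, [𝔥]_i⟩`, the germ of the rough
integral `∫ Z dXⁱ`. -/
noncomputable def Ztilde {d : ℕ} (N : ℕ) (i : Fin d) (X : ℝ → ℝ → Forest d → ℝ)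
    (Z : ℝ → Forest d → ℝ) (s t : ℝ) : ℝ :=
  ∑ᶠ f ∈ {f : Forest d | f.order ≤ N - 1}, Z s f * X s t (graft i f)

theorem size_node {d : ℕ} (a : Fin d) (ts : List (LTree d)) :
    (LTree.node a ts).size = 1 + (ts.map LTree.size).sum := by
  rw [LTree.size]
  congr 2
  exact List.attach_map_val (l := ts) (f := LTree.size)

theorem coprodT_node {d : ℕ} (a : Fin d) (ts : List (LTree d)) :
    coprodT (LTree.node a ts) =
      ((FreeMonoid.of (LTree.node a ts), (1 : Forest d)), (1 : ℝ)) ::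
        (((ts.map coprodT).foldr Tensor.mul (Tensor.one d)).map
          fun q => ((q.1.1, graft a q.1.2), q.2)) := by
  rw [coprodT]
  congr 3
  exact List.attach_map_val (l := ts) (f := coprodT)

theorem order_one' {d : ℕ} : Forest.order (1 : Forest d) = 0 := rfl

theorem order_mul' {d : ℕ} (f g : Forest d) :
    Forest.order (f * g) = f.order + g.order := by
  simp [Forest.order, FreeMonoid.toList_mul]

theorem order_graft {d : ℕ} (a : Fin d) (f : Forest d) :
    (graft a f).order = 1 + f.order := by
  simp [Forest.order, graft, FreeMonoid.toList_of, size_node]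

theorem foldr_order {d : ℕ} (ts : List (LTree d))
    (h : ∀ τ ∈ ts, ∀ q ∈ coprodT τ, Forest.order q.1.2 ≤ τ.size) :
    ∀ q ∈ (ts.map coprodT).foldr Tensor.mul (Tensor.one d),
      Forest.order q.1.2 ≤ (ts.map LTree.size).sum := by
  induction ts with
  | nil => intro q hq; simp [Tensor.one] at hq; subst hq; simp [order_one']
  | cons τ ts ih =>
    intro q hq
    simp only [List.map_cons, List.foldr_cons, Tensor.mul, List.mem_flatMap, List.mem_map] at hq
    obtain ⟨a, ha, b, hb, rfl⟩ := hq
    have h1 := h τ (by simp) a ha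
    have h2 := ih (fun σ hσ => h σ (by simp [hσ])) b hb
    simp only [order_mul', List.map_cons, List.sum_cons]
    omega

theorem coprodT_order {d : ℕ} : ∀ (τ : LTree d), ∀ q ∈ coprodT τ, Forest.order q.1.2 ≤ τ.size
  | .node a ts => by
    intro q hq
    rw [coprodT_node, List.mem_cons, List.mem_map] at hq
    rw [size_node]
    rcases hq with rfl | ⟨p, hp, rfl⟩
    · simp [order_one']
    · have := foldr_order ts (fun τ hτ => coprodT_order τ) p hp
      simp only [order_graft]
      omega
termination_by τ => sizeOf τ
decreasing_by
  have := List.sizeOf_lt_of_mem hτ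
  simp
  omega

theorem coprodF_order {d : ℕ} (f : Forest d) : ∀ q ∈ coprodF f, Forest.order q.1.2 ≤ f.order :=
  foldr_order f.toList (fun τ _ => coprodT_order τ)

theorem finite_order {d : ℕ} (n : ℕ) : {f : Forest d | f.order ≤ n}.Finite := by
  induction n with
  | zero =>
    refine (Set.finite_singleton (1 : Forest d)).subset ?_
    intro f hf
    induction f using FreeMonoid.casesOn with
    | one => rfl
    | of_mul τ f =>
      exfalso
      cases τ
      simp [order_mul', Forest.order, size_node] at hf
  | succ n ih =>
    refine ((Set.finite_singleton (1 : Forest d)).union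
      (Set.Finite.image2 (fun (g f : Forest d) => g * f)
        (Set.Finite.image2 graft (Set.finite_univ (α := Fin d)) ih) ih)).subset ?_
    intro f hf
    induction f using FreeMonoid.casesOn with
    | one => left; rfl
    | of_mul τ f =>
      right
      obtain ⟨a, ts⟩ := τ
      have hg : FreeMonoid.of (LTree.node a ts) = graft a (FreeMonoid.ofList ts) := rfl
      rw [hg] at hf ⊢
      rw [Set.mem_ofPred_eq, order_mul', order_graft] at hf
      exact ⟨_, ⟨a, Set.mem_univ _, _, by simp only [Set.mem_ofPred_eq]; omega, rfl⟩, f,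
        by simp only [Set.mem_ofPred_eq]; omega, rfl⟩

theorem sweedler_graft {d : ℕ} (F G : Forest d → ℝ) (a : Fin d) (f : Forest d) :
    sweedler F G (graft a f) = F (graft a f) * G 1 +
      ((coprodF f).map fun q => q.2 * F q.1.1 * G (graft a q.1.2)).sum := by
  have h : coprodF (graft a f) = coprodT (LTree.node a f.toList) := by
    simp [coprodF, graft, Tensor.mul, Tensor.one]
  rw [sweedler, h, coprodT_node]
  simp only [List.map_cons, List.sum_cons, List.map_map, one_mul]
  rfl

theorem list_swap {d : ℕ} (S : Finset (Forest d)) (F G : Forest d → ℝ) (L : Tensor d)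
    (h : ∀ q ∈ L, q.1.2 ∈ S) :
    ∑ f ∈ S, G f * (L.map fun q => if q.1.2 = f then q.2 * F q.1.1 else 0).sum =
      (L.map fun q => q.2 * F q.1.1 * G q.1.2).sum := by
  induction L with
  | nil => simp
  | cons q L ih =>
    simp only [List.map_cons, List.sum_cons, mul_add, Finset.sum_add_distrib]
    rw [ih (fun p hp => h p (by simp [hp]))]
    have := h q (by simp)
    simp [this, mul_comm]

/-- If `X : [0,T]² → H*` is a family of unital linear functionals on the forest algebra
satisfying Chen's relation, `Z : [0,T] → H_{N−1}` is any path with coefficients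
`⟨𝔥, Z(t)⟩` on forests of order `≤ N−1`, and `R^𝔥` and `Z̃` are as above, then
`Z̃_{s,t} − Z̃_{s,u} − Z̃_{u,t} = − Σ_{𝔥 : |𝔥| ≤ N−1} ⟨X_{u,t}, [𝔥]_i⟩ R^𝔥_{s,u}`. -/
theorem Ztilde_coboundary
    (d N : ℕ) (hd : 1 ≤ d) (hN : 1 ≤ N) (i : Fin d) (T : ℝ)
    (X : ℝ → ℝ → Forest d → ℝ)
    (hunit : ∀ s t, s ∈ Set.Icc (0 : ℝ) T → t ∈ Set.Icc (0 : ℝ) T → X s t 1 = 1)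
    (hChen : ∀ s u t, s ∈ Set.Icc (0 : ℝ) T → u ∈ Set.Icc (0 : ℝ) T →
        t ∈ Set.Icc (0 : ℝ) T → ∀ f : Forest d,
        X s t f = sweedler (X s u) (X u t) f)
    (Z : ℝ → Forest d → ℝ) :
    ∀ s u t, s ∈ Set.Icc (0 : ℝ) T → u ∈ Set.Icc (0 : ℝ) T → t ∈ Set.Icc (0 : ℝ) T →
      Ztilde N i X Z s t - Ztilde N i X Z s u - Ztilde N i X Z u t =
        - ∑ᶠ f ∈ {f : Forest d | f.order ≤ N - 1},
            X u t (graft i f) * Rrem N X Z f s u := by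
  intro s u t hs hu ht
  have hfin := finite_order (d := d) (N - 1)
  set S := hfin.toFinset with hS
  have key : ∀ φ : Forest d → ℝ,
      ∑ᶠ f ∈ {f : Forest d | f.order ≤ N - 1}, φ f = ∑ f ∈ S, φ f := fun φ =>
    finsum_mem_eq_finite_toFinset_sum φ hfin
  simp only [Ztilde, Rrem, key]
  have h1 : ∀ f ∈ S, Z s f * X s t (graft i f) = Z s f * X s u (graft i f) +
      ∑ h ∈ S, X u t (graft i h) * (Z s f *
        ((coprodF f).map fun q => if q.1.2 = h then q.2 * X s u q.1.1 else 0).sum) := by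
    intro f hf
    have hf' : f.order ≤ N - 1 := by simpa [hS] using hf
    rw [hChen s u t hs hu ht, sweedler_graft, hunit u t hu ht, mul_one, mul_add,
      ← list_swap S (X s u) (fun h => X u t (graft i h)) (coprodF f) (by
        intro q hq
        have := coprodF_order f q hq
        simp only [hS, Set.Finite.mem_toFinset, Set.mem_ofPred_eq]
        omega), Finset.mul_sum]
    congr 1
    exact Finset.sum_congr rfl fun h _ => by ring
  rw [Finset.sum_congr rfl h1, Finset.sum_add_distrib, Finset.sum_comm]
  simp only [mul_sub, Finset.sum_sub_distrib, Finset.mul_sum]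
  have h2 : ∑ f ∈ S, Z u f * X u t (graft i f) = ∑ f ∈ S, X u t (graft i f) * Z u f :=
    Finset.sum_congr rfl fun h _ => by ring
  rw [h2]
  ring
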